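/- Let c : Fin n → ℤ and let z ∈ ℂ^n, and suppose there exists j with z j = 0 and c j ≠ 0. Then the orbit of z under the coordinatewise action of the full torus T^n coincides, as a subset of ℂ^n, with the orbit of z under the restricted action of the subgroup T'_c. -/

import Mathlib

open scoped BigOperators

noncomputable def torusChar {n : ℕ} (c : Fin n → ℤ) : (Fin n → Circle) →* Circle where
  toFun t := ∏ i, t i ^ c i
  map_one' := by simp
  map_mul' a b := by simp [mul_zpow, Finset.prod_mul_distrib]

noncomputable def torusKer {n : ℕ} (c : Fin n → ℤ) : Subgroup (Fin n → Circle) :=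
  (torusChar c).ker

theorem Circle.zpow_surjective {m : ℤ} (hm : m ≠ 0) :
    Function.Surjective (fun w : Circle => w ^ m) := by
  intro u
  obtain ⟨x, rfl⟩ := Circle.exp_surjective u
  refine ⟨Circle.exp (x / m), ?_⟩
  have hm' : (m : ℝ) ≠ 0 := Int.cast_ne_zero.mpr hm
  simp only [← Circle.exp_intCast_mul]
  rw [mul_div_cancel₀ x hm']

theorem torusChar_mulSingle {n : ℕ} (c : Fin n → ℤ) (j : Fin n) (w : Circle) :
    torusChar c (Pi.mulSingle j w) = w ^ c j := by
  change ∏ i, (Pi.mulSingle j w : Fin n → Circle) i ^ c i = w ^ c j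
  rw [Finset.prod_eq_single j] <;> simp +contextual

theorem mulSingle_smul_eq_self {n : ℕ} {z : Fin n → ℂ} {j : Fin n} (hz : z j = 0)
    (w : Circle) : (Pi.mulSingle j w : Fin n → Circle) • z = z := by
  ext i
  rw [Pi.smul_apply']
  rcases eq_or_ne i j with rfl | hij
  · simp [hz]
  · simp [hij]

/-- if some coordinate `z j` vanishes with `c j ≠ 0`, the `T^n`-orbit of `z`
coincides with the `T'_c`-orbit of `z` as a subset of `ℂ^n`. -/
theorem orbit_full_torus_eq_orbit_torusKer
    (n : ℕ) (c : Fin n → ℤ) (z : Fin n → ℂ) (h : ∃ j, z j = 0 ∧ c j ≠ 0) :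
    MulAction.orbit (Fin n → Circle) z = MulAction.orbit ↥(torusKer c) z := by
  obtain ⟨j, hz, hc⟩ := h
  refine Set.Subset.antisymm ?_ (MulAction.orbit_subgroup_subset (torusKer c) z)
  rintro _ ⟨t, rfl⟩
  obtain ⟨w, hw⟩ := Circle.zpow_surjective hc (torusChar c t)⁻¹
  refine ⟨⟨t * Pi.mulSingle j w, ?_⟩, ?_⟩
  · rw [torusKer, MonoidHom.mem_ker, map_mul, torusChar_mulSingle]
    exact mul_eq_one_iff_eq_inv'.mpr hw
  · change (t * Pi.mulSingle j w) • z = t • z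
    rw [mul_smul, mulSingle_smul_eq_self hz]
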